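/- arXiv:2601.21428 — 2 statements merged into one kernel-verified Lean document; each statement's English description precedes it below -/
import Mathlib

section
/- Let U ∈ ℝ^{k×d} satisfy U Uᵀ = I_k, let M ∈ ℝ^{k×d} and δ ∈ ℝ, and set C := M (I_d − Uᵀ U) and Ũ := U + δ C. Then Ũ Ũᵀ = I_k + δ² C Cᵀ; in particular every eigenvalue of Ũ Ũᵀ is at least 1 and Ũ has rank k. Moreover, if Ũᵀ = Q R with Q ∈ ℝ^{d×k} satisfying Qᵀ Q = I_k and R ∈ ℝ^{k×k} (a reduced QR factorization), then Rᵀ R = I_k + δ² C Cᵀ, every eigenvalue of Rᵀ R and of R Rᵀ is at least 1 (i.e. R Rᵀ ⪰ I_k), and R is invertible. -/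
open scoped Matrix

noncomputable section

open Matrix in
/-- If `A - 1` is positive semidefinite, then every spectral value of `A` is at least `1`. -/
theorem one_le_of_mem_spectrum_of_posSemidef_sub_one {n : Type*} [Fintype n] [DecidableEq n]
    {A : Matrix n n ℝ} (hA : (A - 1).PosSemidef) : ∀ lam ∈ spectrum ℝ A, 1 ≤ lam := by
  intro lam hlam
  by_contra! hlt
  have hpos : ((1 - lam) • (1 : Matrix n n ℝ) + (A - 1)).PosDef :=
    (PosDef.one.smul (sub_pos.mpr hlt)).add_posSemidef hA
  refine hlam ?_
  have heq : algebraMap ℝ (Matrix n n ℝ) lam - A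
      = -((1 - lam) • (1 : Matrix n n ℝ) + (A - 1)) := by
    rw [Algebra.algebraMap_eq_smul_one, sub_smul, one_smul]
    abel
  rw [spectrum.mem_resolventSet_iff, heq]
  exact hpos.isUnit.neg

open Matrix in
/-- If `A - 1` is positive semidefinite, then `A` is invertible. -/
theorem isUnit_of_posSemidef_sub_one {n : Type*} [Fintype n] [DecidableEq n]
    {A : Matrix n n ℝ} (hA : (A - 1).PosSemidef) : IsUnit A := by
  have hpos : (1 + (A - 1)).PosDef := PosDef.one.add_posSemidef hA
  rw [add_sub_cancel] at hpos
  exact hpos.isUnit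

open Matrix in
/-- A square real matrix `R` is invertible as soon as `Rᵀ R ⪰ 1`. -/
theorem isUnit_of_posSemidef_transpose_mul_self_sub_one {n : Type*} [Fintype n] [DecidableEq n]
    {R : Matrix n n ℝ} (hR : (Rᵀ * R - 1).PosSemidef) : IsUnit R := by
  have h := isUnit_of_posSemidef_sub_one hR
  rw [isUnit_iff_isUnit_det, det_mul] at h
  rw [isUnit_iff_isUnit_det]
  exact isUnit_of_mul_isUnit_right h

open Matrix in
/-- For a square real matrix, `Rᵀ R ⪰ 1` implies `R Rᵀ ⪰ 1`. -/
theorem posSemidef_self_mul_transpose_sub_one {n : Type*} [Fintype n] [DecidableEq n]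
    {R : Matrix n n ℝ} (hR : (Rᵀ * R - 1).PosSemidef) : (R * Rᵀ - 1).PosSemidef := by
  have hdet : IsUnit R.det :=
    (isUnit_iff_isUnit_det R).mp (isUnit_of_posSemidef_transpose_mul_self_sub_one hR)
  have hinv : R * R⁻¹ = 1 := mul_nonsing_inv R hdet
  have hinvT : (R⁻¹)ᵀ * Rᵀ = 1 := by rw [← transpose_mul, hinv, transpose_one]
  have hpsd : ((Rᵀ * R - 1) * (Rᵀ * R - 1)ᴴ + (Rᵀ * R - 1)).PosSemidef :=
    (posSemidef_self_mul_conjTranspose _).add hR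
  have hfactor : (Rᵀ * R - 1) * (Rᵀ * R - 1)ᴴ + (Rᵀ * R - 1) = Rᵀ * (R * Rᵀ - 1) * R := by
    rw [hR.isHermitian.eq]
    noncomm_ring
  have hcancel : (R⁻¹)ᴴ * (Rᵀ * (R * Rᵀ - 1) * R) * R⁻¹ = R * Rᵀ - 1 := by
    calc (R⁻¹)ᴴ * (Rᵀ * (R * Rᵀ - 1) * R) * R⁻¹
        = ((R⁻¹)ᵀ * Rᵀ) * (R * Rᵀ - 1) * (R * R⁻¹) := by
          simp only [conjTranspose_eq_transpose_of_trivial, Matrix.mul_assoc]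
      _ = R * Rᵀ - 1 := by rw [hinvT, hinv, Matrix.one_mul, Matrix.mul_one]
  rw [← hcancel, ← hfactor]
  exact hpsd.conjTranspose_mul_mul_same R⁻¹

/-- Let `U ∈ ℝ^{k×d}` with `U Uᵀ = I_k`, `M ∈ ℝ^{k×d}`, `δ ∈ ℝ`, and set
`C := M (I_d − Uᵀ U)` and `Ũ := U + δ C`. Then `Ũ Ũᵀ = I_k + δ² C Cᵀ`; every eigenvalue of
`Ũ Ũᵀ` is at least `1` and `Ũ` has rank `k`. Moreover, if `Ũᵀ = Q R` is a reduced QR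
factorization (`Qᵀ Q = I_k`), then `Rᵀ R = I_k + δ² C Cᵀ`, every eigenvalue of `Rᵀ R` and of
`R Rᵀ` is at least `1` (i.e. `R Rᵀ ⪰ I_k`), and `R` is invertible. -/
theorem stmt0 {k d : ℕ} (U M : Matrix (Fin k) (Fin d) ℝ) (δ : ℝ)
    (hU : U * Uᵀ = 1)
    (C Utld : Matrix (Fin k) (Fin d) ℝ)
    (hC : C = M * (1 - Uᵀ * U)) (hUtld : Utld = U + δ • C) :
    Utld * Utldᵀ = 1 + δ ^ 2 • (C * Cᵀ) ∧
    (∀ lam ∈ spectrum ℝ (Utld * Utldᵀ), 1 ≤ lam) ∧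
    Utld.rank = k ∧
    ∀ (Q : Matrix (Fin d) (Fin k) ℝ) (R : Matrix (Fin k) (Fin k) ℝ),
      Utldᵀ = Q * R → Qᵀ * Q = 1 →
        (Rᵀ * R = 1 + δ ^ 2 • (C * Cᵀ) ∧
        (∀ lam ∈ spectrum ℝ (Rᵀ * R), 1 ≤ lam) ∧
        (∀ lam ∈ spectrum ℝ (R * Rᵀ), 1 ≤ lam) ∧
        (R * Rᵀ - 1).PosSemidef ∧
        IsUnit R) := by
  have hCU : C * Uᵀ = 0 := by
    rw [hC, Matrix.mul_assoc, Matrix.sub_mul, Matrix.mul_assoc, hU, Matrix.one_mul,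
      Matrix.mul_one, sub_self, Matrix.mul_zero]
  have hUC : U * Cᵀ = 0 := by
    simpa using congrArg Matrix.transpose hCU
  have hgram : Utld * Utldᵀ = 1 + δ ^ 2 • (C * Cᵀ) := by
    rw [hUtld, Matrix.transpose_add, Matrix.transpose_smul, Matrix.add_mul, Matrix.mul_add,
      Matrix.mul_add, Matrix.mul_smul, Matrix.smul_mul, Matrix.smul_mul, Matrix.mul_smul,
      hU, hUC, hCU, smul_zero, smul_smul, add_zero, zero_add, sq]
  have hpsd : (1 + δ ^ 2 • (C * Cᵀ) - 1).PosSemidef := by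
    rw [add_sub_cancel_left, ← Matrix.conjTranspose_eq_transpose_of_trivial]
    exact (Matrix.posSemidef_self_mul_conjTranspose C).smul (sq_nonneg δ)
  refine ⟨hgram, ?_, ?_, fun Q R hQR hQ => ?_⟩
  · rw [hgram]
    exact one_le_of_mem_spectrum_of_posSemidef_sub_one hpsd
  · rw [← Matrix.rank_self_mul_transpose, hgram,
      Matrix.rank_of_isUnit _ (isUnit_of_posSemidef_sub_one hpsd), Fintype.card_fin]
  · have hRR : Rᵀ * R = 1 + δ ^ 2 • (C * Cᵀ) := by
      rw [← hgram, ← Matrix.transpose_transpose Utld, hQR, Matrix.transpose_transpose,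
        Matrix.transpose_mul, Matrix.mul_assoc, ← Matrix.mul_assoc Qᵀ, hQ, Matrix.one_mul]
    rw [← hRR] at hpsd
    have hpsd' := posSemidef_self_mul_transpose_sub_one hpsd
    exact ⟨hRR, one_le_of_mem_spectrum_of_posSemidef_sub_one hpsd,
      one_le_of_mem_spectrum_of_posSemidef_sub_one hpsd', hpsd',
      isUnit_of_posSemidef_transpose_mul_self_sub_one hpsd⟩
end
end

section
/- Let Y ∈ L²(Ω; ℝ^k) be such that C_Y := 𝔼[Y Yᵀ] is invertible, and let U ∈ ℝ^{k×d} satisfy U Uᵀ = I_k. Define the maps P_Y, P : L²(Ω; ℝ^d) → L²(Ω; ℝ^d) by P_Y[Z] := 𝔼[Z Yᵀ] C_Y^{-1} Y and P[Z] := (I_d − Uᵀ U) P_Y[Z] + Uᵀ U Z. Then both P_Y and P are orthogonal projections of L²(Ω; ℝ^d): they are bounded linear operators that are idempotent (P∘P = P) and self-adjoint with respect to the inner product ⟨Z, W⟩ = 𝔼[Zᵀ W]. -/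
open MeasureTheory ProbabilityTheory Filter
open scoped Matrix RealInnerProductSpace

noncomputable section

/-- A Brownian increment over a sub-σ-algebra `𝒢` with step `Δt`: square integrable,
independent of `𝒢`, centered, with covariance `Δt · I_m`. -/
def IsBrownianIncrement {Ω : Type*} {mΩ : MeasurableSpace Ω} (μ : Measure Ω)
    (𝒢 : MeasurableSpace Ω) (Δt : ℝ) {m : ℕ} (ΔW : Ω → Fin m → ℝ) : Prop :=
  (∀ i, Measurable fun ω => ΔW ω i) ∧
    Integrable (fun ω => ∑ i, (ΔW ω i) ^ 2) μ ∧
    Indep (MeasurableSpace.comap ΔW MeasurableSpace.pi) 𝒢 μ ∧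
    (∀ i, ∫ ω, ΔW ω i ∂μ = 0) ∧
    (∀ i j, ∫ ω, ΔW ω i * ΔW ω j ∂μ = if i = j then Δt else 0)

/-- The Gram matrix `𝔼[Y Yᵀ]` of a random vector, with entrywise expectations. -/
def gram {Ω : Type*} {mΩ : MeasurableSpace Ω} (μ : Measure Ω) {k : ℕ}
    (Y : Ω → Fin k → ℝ) : Matrix (Fin k) (Fin k) ℝ :=
  Matrix.of fun i j => ∫ ω, Y ω i * Y ω j ∂μ

/-- `Z` is an `L²` random vector: entrywise measurable with integrable squared norm. -/
def MemL2 {Ω : Type*} {mΩ : MeasurableSpace Ω} (μ : Measure Ω) {d : ℕ}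
    (Z : Ω → Fin d → ℝ) : Prop :=
  (∀ i, Measurable fun ω => Z ω i) ∧ Integrable (fun ω => ∑ i, (Z ω i) ^ 2) μ

/-- `P` is an orthogonal projection of `L²(Ω; ℝ^d)`: it maps `L²` to `L²`, is linear,
bounded, idempotent, and self-adjoint for the inner product `⟨Z, W⟩ = 𝔼[Zᵀ W]`. -/
def IsL2OrthogonalProjection {Ω : Type*} {mΩ : MeasurableSpace Ω} (μ : Measure Ω) {d : ℕ}
    (P : (Ω → Fin d → ℝ) → Ω → Fin d → ℝ) : Prop :=
  (∀ Z, MemL2 μ Z → MemL2 μ (P Z)) ∧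
  (∀ Z W, MemL2 μ Z → MemL2 μ W → P (Z + W) = P Z + P W) ∧
  (∀ (c : ℝ) (Z), MemL2 μ Z → P (c • Z) = c • P Z) ∧
  (∃ c : ℝ, ∀ Z, MemL2 μ Z →
    ∫ ω, ∑ i, (P Z ω i) ^ 2 ∂μ ≤ c * ∫ ω, ∑ i, (Z ω i) ^ 2 ∂μ) ∧
  (∀ Z, MemL2 μ Z → P (P Z) = P Z) ∧
  (∀ Z W, MemL2 μ Z → MemL2 μ W →
    ∫ ω, ∑ i, P Z ω i * W ω i ∂μ = ∫ ω, ∑ i, Z ω i * P W ω i ∂μ)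

/-- The cross second-moment matrix `𝔼[Z Wᵀ]` of two random vectors. -/
def crossMoment {Ω : Type*} {mΩ : MeasurableSpace Ω} (μ : Measure Ω) {d e : ℕ}
    (Z : Ω → Fin d → ℝ) (W : Ω → Fin e → ℝ) : Matrix (Fin d) (Fin e) ℝ :=
  Matrix.of fun i j => ∫ ω, Z ω i * W ω j ∂μ

section L2Vectors

variable {Ω : Type*} {mΩ : MeasurableSpace Ω} {μ : Measure Ω} {d e k : ℕ}

theorem memL2_iff {Z : Ω → Fin d → ℝ} :
    MemL2 μ Z ↔ ∀ i, (Measurable fun ω => Z ω i) ∧ MemLp (fun ω => Z ω i) 2 μ := by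
  constructor
  · rintro ⟨hm, hi⟩ i
    refine ⟨hm i, (memLp_two_iff_integrable_sq (hm i).aestronglyMeasurable).2 ?_⟩
    refine hi.mono ((hm i).pow_const 2).aestronglyMeasurable (ae_of_all _ fun ω => ?_)
    rw [Real.norm_of_nonneg (sq_nonneg _),
      Real.norm_of_nonneg (Finset.sum_nonneg fun j _ => sq_nonneg (Z ω j))]
    exact Finset.single_le_sum (f := fun j => Z ω j ^ 2) (fun j _ => sq_nonneg _)
      (Finset.mem_univ i)
  · exact fun h => ⟨fun i => (h i).1, integrable_finsetSum _ fun i _ => (h i).2.integrable_sq⟩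

theorem MemL2.integrable_mul {Z : Ω → Fin d → ℝ} {W : Ω → Fin e → ℝ}
    (hZ : MemL2 μ Z) (hW : MemL2 μ W) (i : Fin d) (j : Fin e) :
    Integrable (fun ω => Z ω i * W ω j) μ :=
  (memL2_iff.1 hZ i).2.integrable_mul (memL2_iff.1 hW j).2

theorem MemL2.add {Z W : Ω → Fin d → ℝ} (hZ : MemL2 μ Z) (hW : MemL2 μ W) :
    MemL2 μ (Z + W) :=
  memL2_iff.2 fun i => ⟨(hZ.1 i).add (hW.1 i), (memL2_iff.1 hZ i).2.add (memL2_iff.1 hW i).2⟩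

theorem MemL2.mulVec {Z : Ω → Fin d → ℝ} (hZ : MemL2 μ Z) (A : Matrix (Fin e) (Fin d) ℝ) :
    MemL2 μ (fun ω => A.mulVec (Z ω)) :=
  memL2_iff.2 fun i => by
    simp only [Matrix.mulVec, dotProduct]
    exact ⟨Finset.measurable_fun_sum _ fun j _ => (hZ.1 j).const_mul (A i j),
      memLp_finsetSum _ fun j _ => (memL2_iff.1 hZ j).2.const_mul (A i j)⟩

theorem crossMoment_transpose (Z : Ω → Fin d → ℝ) (W : Ω → Fin e → ℝ) :
    (crossMoment μ Z W)ᵀ = crossMoment μ W Z := by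
  ext i j
  simp [crossMoment, mul_comm]

theorem crossMoment_add_left {Z Z' : Ω → Fin d → ℝ} {W : Ω → Fin e → ℝ}
    (hZ : MemL2 μ Z) (hZ' : MemL2 μ Z') (hW : MemL2 μ W) :
    crossMoment μ (Z + Z') W = crossMoment μ Z W + crossMoment μ Z' W := by
  ext i j
  simp only [crossMoment, Matrix.of_apply, Matrix.add_apply, Pi.add_apply, add_mul]
  exact integral_add (hZ.integrable_mul hW i j) (hZ'.integrable_mul hW i j)

theorem crossMoment_smul_left (c : ℝ) (Z : Ω → Fin d → ℝ) (W : Ω → Fin e → ℝ) :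
    crossMoment μ (c • Z) W = c • crossMoment μ Z W := by
  ext i j
  simp [crossMoment, mul_assoc, integral_const_mul]

theorem crossMoment_mulVec_left {Z : Ω → Fin d → ℝ} {W : Ω → Fin e → ℝ}
    (hZ : MemL2 μ Z) (hW : MemL2 μ W) (A : Matrix (Fin k) (Fin d) ℝ) :
    crossMoment μ (fun ω => A.mulVec (Z ω)) W = A * crossMoment μ Z W := by
  ext i j
  simp only [crossMoment, Matrix.of_apply, Matrix.mul_apply, Matrix.mulVec, dotProduct,
    Finset.sum_mul, mul_assoc]
  rw [integral_finsetSum _ fun l _ => (hZ.integrable_mul hW l j).const_mul (A i l)]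
  simp only [integral_const_mul]

theorem integral_sum_mul_eq_trace {Z W : Ω → Fin d → ℝ} (hZ : MemL2 μ Z) (hW : MemL2 μ W) :
    ∫ ω, ∑ i, Z ω i * W ω i ∂μ = (crossMoment μ Z W).trace :=
  integral_finsetSum _ fun i _ => hZ.integrable_mul hW i i

/-- An idempotent self-adjoint linear map is a contraction, hence an orthogonal projection. -/
theorem isL2OrthogonalProjection_of_idempotent_of_selfAdjoint
    {P : (Ω → Fin d → ℝ) → Ω → Fin d → ℝ}
    (hmem : ∀ Z, MemL2 μ Z → MemL2 μ (P Z))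
    (hadd : ∀ Z W, MemL2 μ Z → MemL2 μ W → P (Z + W) = P Z + P W)
    (hsmul : ∀ (c : ℝ) (Z), MemL2 μ Z → P (c • Z) = c • P Z)
    (hidem : ∀ Z, MemL2 μ Z → P (P Z) = P Z)
    (hself : ∀ Z W, MemL2 μ Z → MemL2 μ W →
      ∫ ω, ∑ i, P Z ω i * W ω i ∂μ = ∫ ω, ∑ i, Z ω i * P W ω i ∂μ) :
    IsL2OrthogonalProjection μ P := by
  refine ⟨hmem, hadd, hsmul, ⟨1, fun Z hZ => ?_⟩, hidem, hself⟩
  have hPZ := hmem Z hZ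
  have hsq : ∫ ω, ∑ i, (P Z ω i) ^ 2 ∂μ = ∫ ω, ∑ i, Z ω i * P Z ω i ∂μ := by
    simpa only [hidem Z hZ, sq] using hself Z (P Z) hZ hPZ
  have hcross : Integrable (fun ω => ∑ i, Z ω i * P Z ω i) μ :=
    integrable_finsetSum _ fun i _ => hZ.integrable_mul hPZ i i
  have hnonneg : 0 ≤ ∫ ω, (∑ i, (Z ω i) ^ 2 - 2 * ∑ i, Z ω i * P Z ω i)
      + ∑ i, (P Z ω i) ^ 2 ∂μ := by
    refine integral_nonneg fun ω => ?_
    have h : (∑ i, (Z ω i) ^ 2 - 2 * ∑ i, Z ω i * P Z ω i) + ∑ i, (P Z ω i) ^ 2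
        = ∑ i, (Z ω i - P Z ω i) ^ 2 := by
      rw [Finset.mul_sum, ← Finset.sum_sub_distrib, ← Finset.sum_add_distrib]
      exact Finset.sum_congr rfl fun i _ => by ring
    simp only [h]
    exact Finset.sum_nonneg fun i _ => sq_nonneg _
  have hdiff : Integrable (fun ω => ∑ i, (Z ω i) ^ 2 - 2 * ∑ i, Z ω i * P Z ω i) μ :=
    hZ.2.sub (hcross.const_mul 2)
  rw [integral_add hdiff hPZ.2, integral_sub hZ.2 (hcross.const_mul 2), integral_const_mul] at hnonneg
  linarith

/-- For a symmetric idempotent matrix `Q`, applying `Q` to `Z` and `1 - Q` to the projection of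
`Z` onto the span of `Y` is an orthogonal projection. -/
theorem isL2OrthogonalProjection_mulVec_add {Y : Ω → Fin k → ℝ} (hY : MemL2 μ Y)
    (hCY : IsUnit (gram μ Y).det) {Q : Matrix (Fin d) (Fin d) ℝ} (hQ : Q * Q = Q)
    (hQt : Qᵀ = Q) {P : (Ω → Fin d → ℝ) → Ω → Fin d → ℝ}
    (hP : ∀ Z, P Z = (fun ω => ((1 - Q) * (crossMoment μ Z Y * (gram μ Y)⁻¹)).mulVec (Y ω))
      + fun ω => Q.mulVec (Z ω)) :
    IsL2OrthogonalProjection μ P := by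
  have hmem : ∀ Z, MemL2 μ Z → MemL2 μ (P Z) := fun Z hZ => by
    rw [hP]
    exact (hY.mulVec _).add (hZ.mulVec _)
  have hcross : ∀ {n : ℕ} (Z : Ω → Fin d → ℝ) (W : Ω → Fin n → ℝ), MemL2 μ Z → MemL2 μ W →
      crossMoment μ (P Z) W
        = (1 - Q) * (crossMoment μ Z Y * (gram μ Y)⁻¹) * crossMoment μ Y W
          + Q * crossMoment μ Z W := fun Z W hZ hW => by
    rw [hP, crossMoment_add_left (hY.mulVec _) (hZ.mulVec _) hW,
      crossMoment_mulVec_left hY hW, crossMoment_mulVec_left hZ hW]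
  refine isL2OrthogonalProjection_of_idempotent_of_selfAdjoint hmem ?_ ?_ ?_ ?_
  · intro Z W hZ hW
    simp only [hP, crossMoment_add_left hZ hW hY]
    ext ω i
    simp only [Pi.add_apply, Matrix.mulVec_add, Matrix.add_mul, Matrix.mul_add, Matrix.add_mulVec]
    ring
  · intro c Z _
    simp only [hP, crossMoment_smul_left]
    ext ω i
    simp only [Pi.add_apply, Pi.smul_apply, Matrix.mulVec_smul, Matrix.smul_mul, Matrix.mul_smul,
      Matrix.smul_mulVec, smul_add]
  · intro Z hZ
    have hZY : crossMoment μ (P Z) Y = crossMoment μ Z Y := by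
      rw [hcross Z Y hZ hY, show crossMoment μ Y Y = gram μ Y from rfl, Matrix.mul_assoc,
        Matrix.nonsing_inv_mul_cancel_right _ _ hCY, ← Matrix.add_mul, sub_add_cancel,
        Matrix.one_mul]
    rw [hP (P Z), hZY]
    nth_rw 2 [hP Z]
    rw [hP Z]
    ext ω i
    have hQ0 : Q * (1 - Q) = 0 := by rw [Matrix.mul_sub, hQ, Matrix.mul_one, sub_self]
    simp only [Pi.add_apply, Matrix.mulVec_add, Matrix.mulVec_mulVec, ← Matrix.mul_assoc, hQ, hQ0,
      Matrix.zero_mul, Matrix.zero_mulVec, zero_add]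
  · intro Z W hZ hW
    have hGt : ((gram μ Y)⁻¹)ᵀ = (gram μ Y)⁻¹ := by
      rw [Matrix.transpose_nonsing_inv]
      exact congrArg _ (crossMoment_transpose Y Y)
    rw [integral_sum_mul_eq_trace (hmem Z hZ) hW, integral_sum_mul_eq_trace hZ (hmem W hW),
      ← crossMoment_transpose (P W) Z, hcross Z W hZ hW, hcross W Z hW hZ]
    simp only [Matrix.transpose_add, Matrix.transpose_mul, Matrix.transpose_sub,
      Matrix.transpose_one, crossMoment_transpose, hGt, hQt, Matrix.trace_add]
    rw [Matrix.trace_mul_comm Q, Matrix.mul_assoc (1 - Q), Matrix.trace_mul_comm (1 - Q)]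
    simp only [Matrix.mul_assoc]

end L2Vectors

/-- With `C_Y = 𝔼[Y Yᵀ]` invertible and `U Uᵀ = I_k`, the maps
`P_Y[Z] = 𝔼[Z Yᵀ] C_Y⁻¹ Y` and `P[Z] = (I_d − Uᵀ U) P_Y[Z] + Uᵀ U Z` are both orthogonal
projections of `L²(Ω; ℝ^d)` (equation (3.7) of the paper). -/
theorem stmt11 {Ω : Type*} [m0 : MeasurableSpace Ω] (μ : Measure Ω) [IsProbabilityMeasure μ]
    {k d : ℕ} (Y : Ω → Fin k → ℝ)
    (hYmeas : ∀ i, Measurable fun ω => Y ω i)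
    (hYint : Integrable (fun ω => ∑ i, (Y ω i) ^ 2) μ)
    (hCY : IsUnit (gram μ Y).det)
    (U : Matrix (Fin k) (Fin d) ℝ) (hU : U * Uᵀ = 1)
    (PY P : (Ω → Fin d → ℝ) → Ω → Fin d → ℝ)
    (hPY : ∀ Z ω, PY Z ω =
      ((Matrix.of fun i j => ∫ ω', Z ω' i * Y ω' j ∂μ) * (gram μ Y)⁻¹).mulVec (Y ω))
    (hP : ∀ Z ω, P Z ω = (1 - Uᵀ * U).mulVec (PY Z ω) + ((Uᵀ * U).mulVec (Z ω))) :
    IsL2OrthogonalProjection μ PY ∧ IsL2OrthogonalProjection μ P := by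
  have hY : MemL2 μ Y := ⟨hYmeas, hYint⟩
  constructor
  · refine isL2OrthogonalProjection_mulVec_add hY hCY (Q := 0) (by simp) (by simp) fun Z => ?_
    ext ω i
    simp [hPY, crossMoment]
  · refine isL2OrthogonalProjection_mulVec_add hY hCY (Q := Uᵀ * U) ?_ (by simp) fun Z => ?_
    · rw [Matrix.mul_assoc, ← Matrix.mul_assoc U, hU, Matrix.one_mul]
    · ext ω i
      simp only [hP, hPY, crossMoment, Matrix.mulVec_mulVec, Pi.add_apply]
end
end
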